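/- arXiv:2008.11895 — 7 statements merged into one kernel-verified Lean document; each statement's English description precedes it below -/
import Mathlib

section
/- Let H be a real Hilbert space, N ≥ 1 an integer, and ε > 0. Fix h̄_1,…,h̄_N, ḡ ∈ H, and suppose (h_1,…,h_N, g) ∈ H^{N+1} is a global minimizer of the functional J(h_1',…,h_N',g') = Σ_{i=1}^N ‖h_i' − h̄_i‖² + ‖g' − ḡ‖² over the cross-learning constraint set C. Then for every i = 1,…,N there exists a scalar ζ_i ∈ [0,1] such that h_i = ζ_i h̄_i + (1 − ζ_i) g. -/
/-- A nearest point `x` to `a` in the closed ball of radius `ε` around `g` lies on the segment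
joining `g` to `a`. -/
theorem exists_eq_smul_add_smul_of_forall_norm_sub_le {E : Type*} [NormedAddCommGroup E]
    [NormedSpace ℝ E] [StrictConvexSpace ℝ E] {ε : ℝ} (hε : 0 ≤ ε) {x a g : E}
    (hx : ‖x - g‖ ≤ ε) (hmin : ∀ y, ‖y - g‖ ≤ ε → ‖x - a‖ ≤ ‖y - a‖) :
    ∃ ζ : ℝ, ζ ∈ Set.Icc (0 : ℝ) 1 ∧ x = ζ • a + (1 - ζ) • g := by
  rcases le_or_gt ‖a - g‖ ε with ha | ha
  · have hxa : x = a := by simpa [sub_eq_zero] using hmin a ha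
    exact ⟨1, by simp, by simp [hxa]⟩
  · have hd : 0 < ‖a - g‖ := hε.trans_lt ha
    set ζ : ℝ := ε / ‖a - g‖ with hζ
    have hζ0 : 0 ≤ ζ := by positivity
    have hζ1 : ζ ≤ 1 := (div_le_one hd).2 ha.le
    have hmul : ζ * ‖a - g‖ = ε := div_mul_cancel₀ _ hd.ne'
    have hyg : ‖(ζ • a + (1 - ζ) • g) - g‖ = ε := by
      rw [show (ζ • a + (1 - ζ) • g) - g = ζ • (a - g) by module, norm_smul,
        Real.norm_of_nonneg hζ0, hmul]
    have hya : ‖(ζ • a + (1 - ζ) • g) - a‖ = (1 - ζ) * ‖a - g‖ := by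
      rw [show (ζ • a + (1 - ζ) • g) - a = -((1 - ζ) • (a - g)) by module, norm_neg, norm_smul,
        Real.norm_of_nonneg (sub_nonneg.2 hζ1)]
    have hxa : ‖x - a‖ ≤ (1 - ζ) * ‖a - g‖ := hya ▸ hmin _ hyg.le
    have htri : ‖a - g‖ ≤ ‖x - a‖ + ‖x - g‖ := by
      simpa [norm_sub_rev a x] using norm_sub_le_norm_sub_add_norm_sub a x g
    have hline : x = AffineMap.lineMap g a ζ := by
      apply eq_lineMap_of_dist_eq_mul_of_dist_eq_mul
      · rw [dist_eq_norm', dist_eq_norm']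
        linarith
      · rw [dist_eq_norm, dist_eq_norm']
        linarith
    refine ⟨ζ, ⟨hζ0, hζ1⟩, ?_⟩
    rw [hline, AffineMap.lineMap_apply_module, add_comm]

/-- Any global minimizer of the cross-learning projection objective
`J(h',g') = Σ_i ‖h_i' − h̄_i‖² + ‖g' − ḡ‖²` over the constraint set
`C = {(h,g) : ‖h_i − g‖ ≤ ε ∀ i}` has each `h_i` a convex combination of `h̄_i` and `g`. -/
theorem stmt0 {H : Type*} [NormedAddCommGroup H] [InnerProductSpace ℝ H] [CompleteSpace H]
    {N : ℕ} (hN : 1 ≤ N) {ε : ℝ} (hε : 0 < ε)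
    (hbar : Fin N → H) (gbar : H) (h : Fin N → H) (g : H)
    (hfeas : ∀ i, ‖h i - g‖ ≤ ε)
    (hmin : ∀ (h' : Fin N → H) (g' : H), (∀ i, ‖h' i - g'‖ ≤ ε) →
      (∑ i, ‖h i - hbar i‖ ^ 2) + ‖g - gbar‖ ^ 2 ≤
        (∑ i, ‖h' i - hbar i‖ ^ 2) + ‖g' - gbar‖ ^ 2) :
    ∀ i, ∃ ζ : ℝ, ζ ∈ Set.Icc (0 : ℝ) 1 ∧ h i = ζ • hbar i + (1 - ζ) • g := by
  intro i
  refine exists_eq_smul_add_smul_of_forall_norm_sub_le hε.le (hfeas i) fun y hy => ?_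
  have hJ := hmin (Function.update h i y) g fun j => by
    rcases eq_or_ne j i with rfl | hj
    · simpa using hy
    · simpa [hj] using hfeas j
  have hrest : ∑ j ∈ Finset.univ.erase i, ‖Function.update h i y j - hbar j‖ ^ 2 =
      ∑ j ∈ Finset.univ.erase i, ‖h j - hbar j‖ ^ 2 :=
    Finset.sum_congr rfl fun j hj => by simp [Finset.ne_of_mem_erase hj]
  rw [← Finset.add_sum_erase _ _ (Finset.mem_univ i),
    ← Finset.add_sum_erase _ (fun j => ‖Function.update h i y j - hbar j‖ ^ 2)
      (Finset.mem_univ i), hrest, Function.update_self] at hJ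
  exact (sq_le_sq₀ (norm_nonneg _) (norm_nonneg _)).1 (by linarith)
end

section
/- Let H be a real Hilbert space, N ≥ 1 an integer, and ε > 0. Fix h̄_1,…,h̄_N, ḡ ∈ H, and suppose (h_1,…,h_N, g) ∈ H^{N+1} is a global minimizer of the functional J(h_1',…,h_N',g') = Σ_{i=1}^N ‖h_i' − h̄_i‖² + ‖g' − ḡ‖² over the cross-learning constraint set C. Then g − ḡ = Σ_{i=1}^N (h̄_i − h_i). -/
/-- The sum of squared distances after moving all points by a multiple of the total
displacement `∑ i, (h i - hbar i) + (g - gbar)`. -/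
theorem sum_sq_norm_translate {H : Type*} [NormedAddCommGroup H] [InnerProductSpace ℝ H]
    {N : ℕ} (hbar : Fin N → H) (gbar : H) (h : Fin N → H) (g : H) (t : ℝ) :
    (∑ i, ‖h i - t • (∑ i, (h i - hbar i) + (g - gbar)) - hbar i‖ ^ 2) +
        ‖g - t • (∑ i, (h i - hbar i) + (g - gbar)) - gbar‖ ^ 2 =
      (∑ i, ‖h i - hbar i‖ ^ 2) + ‖g - gbar‖ ^ 2 +
        (-2 * t * ‖∑ i, (h i - hbar i) + (g - gbar)‖ ^ 2 +
          (N + 1) * t ^ 2 * ‖∑ i, (h i - hbar i) + (g - gbar)‖ ^ 2) := by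
  set s : H := ∑ i, (h i - hbar i) + (g - gbar) with hs
  have expand (x y : H) :
      ‖x - t • s - y‖ ^ 2 = ‖x - y‖ ^ 2 - 2 * t * inner ℝ (x - y) s + t ^ 2 * ‖s‖ ^ 2 := by
    rw [sub_right_comm, norm_sub_sq_real, inner_smul_right, norm_smul, mul_pow,
      Real.norm_eq_abs, sq_abs]
    ring
  have hinner : (∑ i, inner ℝ (h i - hbar i) s) + inner ℝ (g - gbar) s = ‖s‖ ^ 2 := by
    rw [← sum_inner, ← inner_add_left, ← hs, real_inner_self_eq_norm_sq]
  simp only [expand, Finset.sum_add_distrib, Finset.sum_sub_distrib, ← Finset.mul_sum,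
    Finset.sum_const, Finset.card_univ, Fintype.card_fin, nsmul_eq_mul]
  linear_combination (-2 * t) * hinner

/-- At a global minimizer of the cross-learning projection, the
displacement of the center satisfies `g − ḡ = Σ_i (h̄_i − h_i)`. -/
theorem stmt1 {H : Type*} [NormedAddCommGroup H] [InnerProductSpace ℝ H] [CompleteSpace H]
    {N : ℕ} (hN : 1 ≤ N) {ε : ℝ} (hε : 0 < ε)
    (hbar : Fin N → H) (gbar : H) (h : Fin N → H) (g : H)
    (hfeas : ∀ i, ‖h i - g‖ ≤ ε)
    (hmin : ∀ (h' : Fin N → H) (g' : H), (∀ i, ‖h' i - g'‖ ≤ ε) →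
      (∑ i, ‖h i - hbar i‖ ^ 2) + ‖g - gbar‖ ^ 2 ≤
        (∑ i, ‖h' i - hbar i‖ ^ 2) + ‖g' - gbar‖ ^ 2) :
    g - gbar = ∑ i, (hbar i - h i) := by
  set s : H := ∑ i, (h i - hbar i) + (g - gbar) with hs
  have key := hmin (fun i => h i - (1 / ((N : ℝ) + 1)) • s) (g - (1 / ((N : ℝ) + 1)) • s)
    (fun i => by simpa using hfeas i)
  rw [sum_sq_norm_translate] at key
  simp only [← hs] at key
  have hNpos : (0 : ℝ) < (N : ℝ) + 1 := by positivity
  have hcoeff : -2 * (1 / ((N : ℝ) + 1)) * ‖s‖ ^ 2 + (N + 1) * (1 / ((N : ℝ) + 1)) ^ 2 * ‖s‖ ^ 2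
      = -(‖s‖ ^ 2 / (N + 1)) := by
    field_simp
    ring
  have hle : ‖s‖ ^ 2 / ((N : ℝ) + 1) ≤ 0 := by linarith
  have hsq : ‖s‖ ^ 2 ≤ 0 := by
    by_contra! hpos
    exact absurd hle (not_le.mpr (div_pos hpos hNpos))
  have hzero : s = 0 := by
    rw [← norm_eq_zero]
    exact pow_eq_zero_iff two_ne_zero |>.mp (le_antisymm hsq (sq_nonneg _))
  rw [hs, add_comm] at hzero
  rw [eq_neg_of_add_eq_zero_left hzero, ← Finset.sum_neg_distrib]
  simp only [neg_sub]
end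

section
/- Let H be a real Hilbert space, N ≥ 1 an integer, and ε > 0. Fix h̄_1,…,h̄_N, ḡ ∈ H, and suppose (h_1,…,h_N, g) ∈ H^{N+1} is a global minimizer of the functional J(h_1',…,h_N',g') = Σ_{i=1}^N ‖h_i' − h̄_i‖² + ‖g' − ḡ‖² over the cross-learning constraint set C. Then g and each h_i belong to the linear span of the finite set {h̄_1,…,h̄_N, ḡ}. (In particular, if the inputs h̄_1,…,h̄_N, ḡ are finite linear combinations of kernel functions of a reproducing kernel Hilbert space, then so are the projected policies.) -/
/-- Pythagoras for the orthogonal projection: the squared distance to a point of `K` splits. -/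
lemma norm_sub_sq_eq_starProjection {H : Type*} [NormedAddCommGroup H] [InnerProductSpace ℝ H]
    (K : Submodule ℝ H) [K.HasOrthogonalProjection] (x : H) {y : H} (hy : y ∈ K) :
    ‖x - y‖ ^ 2 = ‖K.starProjection x - y‖ ^ 2 + ‖x - K.starProjection x‖ ^ 2 := by
  have hinner : inner ℝ (K.starProjection x - y) (x - K.starProjection x) = 0 :=
    K.inner_right_of_mem_orthogonal (K.sub_mem (K.starProjection_apply_mem x) hy)
      (K.sub_starProjection_mem_orthogonal x)
  have hsplit : x - y = (K.starProjection x - y) + (x - K.starProjection x) := by abel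
  rw [hsplit, norm_add_sq_real, hinner]
  ring

/-- At a global minimizer of the cross-learning projection, the center `g`
and each `h_i` lie in the linear span of the inputs `{h̄_1,…,h̄_N, ḡ}`. -/
theorem stmt2 {H : Type*} [NormedAddCommGroup H] [InnerProductSpace ℝ H] [CompleteSpace H]
    {N : ℕ} (hN : 1 ≤ N) {ε : ℝ} (hε : 0 < ε)
    (hbar : Fin N → H) (gbar : H) (h : Fin N → H) (g : H)
    (hfeas : ∀ i, ‖h i - g‖ ≤ ε)
    (hmin : ∀ (h' : Fin N → H) (g' : H), (∀ i, ‖h' i - g'‖ ≤ ε) →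
      (∑ i, ‖h i - hbar i‖ ^ 2) + ‖g - gbar‖ ^ 2 ≤
        (∑ i, ‖h' i - hbar i‖ ^ 2) + ‖g' - gbar‖ ^ 2) :
    g ∈ Submodule.span ℝ (insert gbar (Set.range hbar)) ∧
      ∀ i, h i ∈ Submodule.span ℝ (insert gbar (Set.range hbar)) := by
  set K := Submodule.span ℝ (insert gbar (Set.range hbar))
  have : FiniteDimensional ℝ K :=
    FiniteDimensional.span_of_finite ℝ ((Set.finite_range hbar).insert gbar)
  have hgbar : gbar ∈ K := Submodule.subset_span (Set.mem_insert _ _)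
  have hhbar : ∀ i, hbar i ∈ K := fun i =>
    Submodule.subset_span (Set.mem_insert_of_mem _ (Set.mem_range_self i))
  have hle := hmin (fun i => K.starProjection (h i)) (K.starProjection g) fun i => by
    rw [← map_sub]
    exact (K.norm_starProjection_apply_le _).trans (hfeas i)
  simp only [fun i => norm_sub_sq_eq_starProjection K (h i) (hhbar i),
    norm_sub_sq_eq_starProjection K g hgbar, Finset.sum_add_distrib] at hle
  have hsum : 0 ≤ ∑ i, ‖h i - K.starProjection (h i)‖ ^ 2 :=
    Finset.sum_nonneg fun i _ => sq_nonneg _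
  have hmem : ∀ x : H, ‖x - K.starProjection x‖ ^ 2 ≤ 0 → x ∈ K := fun x hx => by
    have hzero : ‖x - K.starProjection x‖ = 0 :=
      pow_eq_zero_iff two_ne_zero |>.1 (le_antisymm hx (sq_nonneg _))
    rw [sub_eq_zero.1 (norm_eq_zero.1 hzero)]
    exact K.starProjection_apply_mem x
  refine ⟨hmem g (by linarith), fun i => hmem (h i) ?_⟩
  have hi := Finset.single_le_sum (f := fun i => ‖h i - K.starProjection (h i)‖ ^ 2)
    (fun i _ => sq_nonneg _) (Finset.mem_univ i)
  have hg := sq_nonneg ‖g - K.starProjection g‖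
  linarith
end

section
/- Let H be a real Hilbert space, N ≥ 1 an integer, and ε > 0. Fix h̄_1,…,h̄_N ∈ H and define g = (1/N) Σ_{i=1}^N h̄_i, S = Σ_{i=1}^N ‖h̄_i − g‖², ψ = min{1, √N ε / √S} if S > 0 and ψ = 1 if S = 0, and h_i = (1 − ψ) g + ψ h̄_i for i = 1,…,N. Then (h_1,…,h_N, g) is a global minimizer of Σ_{i=1}^N ‖h_i' − h̄_i‖² over all (h_1',…,h_N', g') ∈ H^{N+1} satisfying the relaxed cross-learning constraint Σ_{i=1}^N ‖h_i' − g'‖² ≤ N ε². -/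
/-- The mean minimizes the sum of squared distances to a finite family of points. -/
theorem sum_norm_sub_mean_sq_le {ι H : Type*} [Fintype ι] [NormedAddCommGroup H]
    [InnerProductSpace ℝ H] {x : ι → H} {g : H} (hg : ∑ i, (x i - g) = 0) (c : H) :
    ∑ i, ‖x i - g‖ ^ 2 ≤ ∑ i, ‖x i - c‖ ^ 2 := by
  have expand (i : ι) : ‖x i - c‖ ^ 2 =
      ‖x i - g‖ ^ 2 + 2 * inner ℝ (x i - g) (g - c) + ‖g - c‖ ^ 2 := by
    rw [← norm_add_sq_real, sub_add_sub_cancel]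
  simp_rw [expand, Finset.sum_add_distrib, ← Finset.mul_sum, ← sum_inner, hg, inner_zero_left]
  have : 0 ≤ ∑ _i : ι, ‖g - c‖ ^ 2 := by positivity
  linarith

/-- Minkowski's inequality for the `ℓ²` norm of a finite family of vectors. -/
theorem sqrt_sum_norm_add_sq_le {ι H : Type*} [Fintype ι] [NormedAddCommGroup H]
    (u v : ι → H) :
    √(∑ i, ‖u i + v i‖ ^ 2) ≤ √(∑ i, ‖u i‖ ^ 2) + √(∑ i, ‖v i‖ ^ 2) := by
  simpa [PiLp.norm_eq_of_L2] using norm_add_le (WithLp.toLp 2 u) (WithLp.toLp 2 v)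

/-- The closed-form tuple `(h_1,…,h_N, g)` with `g` the mean of the `h̄_i`,
`ψ = min{1, √N ε / √S}` (with `S = Σ_i ‖h̄_i − g‖²`, and `ψ = 1` if `S = 0`), and
`h_i = (1 − ψ) g + ψ h̄_i` is a global minimizer of `Σ_i ‖h_i' − h̄_i‖²` over the relaxed
cross-learning constraint `Σ_i ‖h_i' − g'‖² ≤ N ε²`. -/
theorem stmt3 {H : Type*} [NormedAddCommGroup H] [InnerProductSpace ℝ H] [CompleteSpace H]
    {N : ℕ} (hN : 1 ≤ N) {ε : ℝ} (hε : 0 < ε)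
    (hbar : Fin N → H)
    (g : H) (hg : g = (N : ℝ)⁻¹ • ∑ i, hbar i)
    (S : ℝ) (hS : S = ∑ i, ‖hbar i - g‖ ^ 2)
    (ψ : ℝ) (hψ : ψ = if 0 < S then min 1 (Real.sqrt N * ε / Real.sqrt S) else 1)
    (h : Fin N → H) (hh : ∀ i, h i = (1 - ψ) • g + ψ • hbar i) :
    ((∑ i, ‖h i - g‖ ^ 2) ≤ N * ε ^ 2) ∧
      ∀ (h' : Fin N → H) (g' : H), (∑ i, ‖h' i - g'‖ ^ 2) ≤ N * ε ^ 2 →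
        (∑ i, ‖h i - hbar i‖ ^ 2) ≤ ∑ i, ‖h' i - hbar i‖ ^ 2 := by
  have hN' : (N : ℝ) ≠ 0 := by positivity
  have hS0 : 0 ≤ S := hS ▸ by positivity
  have hmean : ∑ i, (hbar i - g) = 0 := by
    simp [hg, Finset.sum_sub_distrib, ← Nat.cast_smul_eq_nsmul ℝ, smul_smul, hN']
  have hfeas : ∑ i, ‖h i - g‖ ^ 2 = ψ ^ 2 * S := by
    rw [hS, Finset.mul_sum]
    refine Finset.sum_congr rfl fun i _ => ?_
    have : h i - g = ψ • (hbar i - g) := by rw [hh]; module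
    rw [this, norm_smul, mul_pow, Real.norm_eq_abs, sq_abs]
  have hobj : ∑ i, ‖h i - hbar i‖ ^ 2 = (1 - ψ) ^ 2 * S := by
    rw [hS, Finset.mul_sum]
    refine Finset.sum_congr rfl fun i _ => ?_
    have : h i - hbar i = (ψ - 1) • (hbar i - g) := by rw [hh]; module
    rw [this, norm_smul, mul_pow, Real.norm_eq_abs, sq_abs]
    ring
  have hr : √(N * ε ^ 2) = √N * ε := by
    rw [Real.sqrt_mul (Nat.cast_nonneg N), Real.sqrt_sq hε.le]
  rw [hfeas, hobj]
  have hψ_cases : (ψ = 1 ∧ √S ≤ √N * ε) ∨ (ψ * √S = √N * ε ∧ ψ ≤ 1) := by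
    split_ifs at hψ with hpos
    · have hs : 0 < √S := Real.sqrt_pos.2 hpos
      rcases le_total 1 (√N * ε / √S) with hle | hle
      · exact .inl ⟨by rw [hψ, min_eq_left hle], by rwa [one_le_div hs] at hle⟩
      · rw [min_eq_right hle] at hψ
        exact .inr ⟨by rw [hψ, div_mul_cancel₀ _ hs.ne'], hψ ▸ hle⟩
    · rw [Real.sqrt_eq_zero_of_nonpos (not_lt.1 hpos)]
      exact .inl ⟨hψ, by positivity⟩
  constructor
  · have hle : ψ * √S ≤ √N * ε := by
      rcases hψ_cases with ⟨rfl, hle⟩ | ⟨heq, -⟩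
      · rwa [one_mul]
      · exact heq.le
    have hnonneg : 0 ≤ ψ * √S := by
      rcases hψ_cases with ⟨rfl, -⟩ | ⟨heq, -⟩
      · positivity
      · rw [heq]; positivity
    calc ψ ^ 2 * S = (ψ * √S) ^ 2 := by rw [mul_pow, Real.sq_sqrt hS0]
      _ ≤ (√N * ε) ^ 2 := by gcongr
      _ = N * ε ^ 2 := by rw [mul_pow, Real.sq_sqrt (Nat.cast_nonneg N)]
  · intro h' g' hfeas'
    rcases hψ_cases with ⟨rfl, -⟩ | ⟨heq, hle⟩
    · simp only [sub_self, ne_eq, OfNat.ofNat_ne_zero, not_false_eq_true, zero_pow, zero_mul]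
      positivity
    have htri : √S ≤ √(∑ i, ‖h' i - hbar i‖ ^ 2) + √N * ε :=
      calc √S ≤ √(∑ i, ‖hbar i - g'‖ ^ 2) :=
            Real.sqrt_le_sqrt (hS ▸ sum_norm_sub_mean_sq_le hmean g')
        _ ≤ √(∑ i, ‖h' i - hbar i‖ ^ 2) + √(∑ i, ‖h' i - g'‖ ^ 2) := by
            simpa [norm_sub_rev] using
              sqrt_sum_norm_add_sq_le (fun i => hbar i - h' i) (fun i => h' i - g')
        _ ≤ √(∑ i, ‖h' i - hbar i‖ ^ 2) + √N * ε := by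
            rw [← hr]
            gcongr
    calc (1 - ψ) ^ 2 * S = ((1 - ψ) * √S) ^ 2 := by rw [mul_pow, Real.sq_sqrt hS0]
      _ ≤ √(∑ i, ‖h' i - hbar i‖ ^ 2) ^ 2 := by
          have : 0 ≤ (1 - ψ) * √S := mul_nonneg (sub_nonneg.2 hle) (Real.sqrt_nonneg S)
          gcongr
          linarith
      _ = ∑ i, ‖h' i - hbar i‖ ^ 2 := Real.sq_sqrt (by positivity)
end

section
/- Let H be a real Hilbert space, N ≥ 1 an integer, and ε > 0. Fix h̄_1,…,h̄_N, ḡ ∈ H. Let (h_1,…,h_N, g) be a global minimizer of J(h_1',…,h_N',g') = Σ_{i=1}^N ‖h_i' − h̄_i‖² + ‖g' − ḡ‖² over the cross-learning constraint set C, and let g' = (1/N) Σ_{i=1}^N h̄_i. If ‖ḡ − g'‖ ≤ ε, then ‖g − g'‖ ≤ ε. -/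
/-- If the sum of squared norms `Σ ‖a i‖² + ‖b‖²` cannot be decreased by translating all the
vectors at once, then the vectors sum to zero. -/
lemma sum_add_eq_zero_of_translation_minimal {ι H : Type*} [Fintype ι] [NormedAddCommGroup H]
    [InnerProductSpace ℝ H] (a : ι → H) (b : H)
    (hmin : ∀ v : H, (∑ i, ‖a i‖ ^ 2) + ‖b‖ ^ 2 ≤ (∑ i, ‖a i + v‖ ^ 2) + ‖b + v‖ ^ 2) :
    (∑ i, a i) + b = 0 := by
  set S := (∑ i, a i) + b with hS
  set n : ℝ := (Fintype.card ι : ℝ) + 1 with hn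
  have hn0 : 0 < n := by positivity
  have expand (v : H) : (∑ i, ‖a i + v‖ ^ 2) + ‖b + v‖ ^ 2
      = (∑ i, ‖a i‖ ^ 2) + ‖b‖ ^ 2 + 2 * inner ℝ S v + n * ‖v‖ ^ 2 := by
    simp only [norm_add_sq_real, Finset.sum_add_distrib, ← Finset.mul_sum, ← sum_inner, hS,
      inner_add_left, Finset.sum_const, Finset.card_univ, nsmul_eq_mul, hn]
    ring
  have key := hmin (-(n⁻¹ • S))
  rw [expand, inner_neg_right, inner_smul_right, real_inner_self_eq_norm_sq, norm_neg, norm_smul,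
    Real.norm_of_nonneg (inv_nonneg.2 hn0.le)] at key
  have hle : n⁻¹ * ‖S‖ ^ 2 ≤ 0 := by
    have : n * (n⁻¹ * ‖S‖) ^ 2 = n⁻¹ * ‖S‖ ^ 2 := by field_simp
    linarith
  have hsq : ‖S‖ ^ 2 ≤ 0 := nonpos_of_mul_nonpos_right hle (inv_pos.2 hn0)
  simpa using le_antisymm hsq (sq_nonneg _)

/-- If the input center `ḡ` is ε-close to the mean `g' = (1/N) Σ_i h̄_i`,
then the center `g` of the cross-learning projection is also ε-close to `g'`. -/
theorem stmt4 {H : Type*} [NormedAddCommGroup H] [InnerProductSpace ℝ H] [CompleteSpace H]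
    {N : ℕ} (hN : 1 ≤ N) {ε : ℝ} (hε : 0 < ε)
    (hbar : Fin N → H) (gbar : H) (h : Fin N → H) (g : H)
    (hfeas : ∀ i, ‖h i - g‖ ≤ ε)
    (hmin : ∀ (h' : Fin N → H) (g' : H), (∀ i, ‖h' i - g'‖ ≤ ε) →
      (∑ i, ‖h i - hbar i‖ ^ 2) + ‖g - gbar‖ ^ 2 ≤
        (∑ i, ‖h' i - hbar i‖ ^ 2) + ‖g' - gbar‖ ^ 2)
    (g' : H) (hg' : g' = (N : ℝ)⁻¹ • ∑ i, hbar i)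
    (hnear : ‖gbar - g'‖ ≤ ε) :
    ‖g - g'‖ ≤ ε := by
  have hN0 : (0 : ℝ) < N := by exact_mod_cast hN
  have hbalance : (∑ i, (h i - hbar i)) + (g - gbar) = 0 := by
    refine sum_add_eq_zero_of_translation_minimal _ _ fun v => ?_
    have := hmin (fun i => h i + v) (g + v) (fun i => by simpa using hfeas i)
    simpa only [add_sub_right_comm] using this
  have hmean : ∑ i, hbar i = (N : ℝ) • g' := by
    rw [hg', smul_smul, mul_inv_cancel₀ hN0.ne', one_smul]
  have hcenter : ((N : ℝ) + 1) • (g - g') = (gbar - g') - ∑ i, (h i - g) := by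
    rw [Finset.sum_sub_distrib, hmean] at hbalance
    rw [Finset.sum_sub_distrib, Finset.sum_const, Finset.card_univ, Fintype.card_fin,
      ← Nat.cast_smul_eq_nsmul ℝ]
    linear_combination (norm := module) hbalance
  have hsum : ‖∑ i, (h i - g)‖ ≤ N * ε := by
    simpa using norm_sum_le_of_le Finset.univ fun i _ => hfeas i
  have hnorm : ((N : ℝ) + 1) * ‖g - g'‖ ≤ (N + 1) * ε := by
    calc ((N : ℝ) + 1) * ‖g - g'‖ = ‖(gbar - g') - ∑ i, (h i - g)‖ := by
          rw [← hcenter, norm_smul, Real.norm_of_nonneg (by positivity)]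
      _ ≤ ‖gbar - g'‖ + ‖∑ i, (h i - g)‖ := norm_sub_le _ _
      _ ≤ (N + 1) * ε := by linarith
  exact le_of_mul_le_mul_left hnorm (by positivity)
end

section
/- Let H be a real Hilbert space, N ≥ 1 an integer, and ε > 0. Fix h̄_1,…,h̄_N, ḡ ∈ H. Let (h_1,…,h_N, g) be a global minimizer of J(h_1',…,h_N',g') = Σ_{i=1}^N ‖h_i' − h̄_i‖² + ‖g' − ḡ‖² over the cross-learning constraint set C. Let g' = (1/N) Σ_{j=1}^N h̄_j, set y_i = ‖h̄_i − g'‖ for each i, assume Σ_{j=1}^N y_j² > 0, set ψ = min{1, √N ε / √(Σ_j y_j²)}, and define h_i' = (1 − ψ) g' + ψ h̄_i. If ‖ḡ − g'‖ ≤ ε, then for every i = 1,…,N, ‖h_i − h_i'‖ ≤ ε (2 + √N · y_i / √(Σ_{j=1}^N y_j²)). -/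
/-- First-order optimality of a minimizer along common translations: the residuals sum to zero. -/
lemma sum_residual_add_eq_zero {ι H : Type*} [Fintype ι] [NormedAddCommGroup H]
    [InnerProductSpace ℝ H] (a : ι → H) (b : H)
    (hmin : ∀ v : H, (∑ i, ‖a i‖ ^ 2) + ‖b‖ ^ 2 ≤ (∑ i, ‖a i + v‖ ^ 2) + ‖b + v‖ ^ 2) :
    ∑ i, a i + b = 0 := by
  set D := ∑ i, a i + b with hD
  set c : ℝ := (Fintype.card ι : ℝ) + 1 with hc
  have hcpos : 0 < c := by positivity
  have key := hmin (-(c⁻¹ • D))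
  have hinner : ∑ i, inner ℝ (a i) D + inner ℝ b D = ‖D‖ ^ 2 := by
    rw [← sum_inner, ← inner_add_left, ← hD, real_inner_self_eq_norm_sq]
  simp only [norm_add_sq_real, norm_neg, inner_neg_right, real_inner_smul_right,
    Finset.sum_add_distrib, ← Finset.mul_sum, Finset.sum_neg_distrib, Finset.sum_const,
    Finset.card_univ, nsmul_eq_mul, norm_smul, norm_inv, Real.norm_eq_abs,
    abs_of_pos hcpos] at key
  have hsq : c * (c⁻¹ * ‖D‖) ^ 2 = c⁻¹ * ‖D‖ ^ 2 := by field_simp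
  have hle : c⁻¹ * ‖D‖ ^ 2 ≤ 0 := by
    have h1 : c⁻¹ * (∑ i, inner ℝ (a i) D + inner ℝ b D) = c⁻¹ * ‖D‖ ^ 2 := by rw [hinner]
    rw [hc] at hsq h1 key ⊢
    linarith
  have hD0 : ‖D‖ ^ 2 ≤ 0 := by
    by_contra! hlt
    exact absurd hle (not_le.mpr (mul_pos (inv_pos.mpr hcpos) hlt))
  simpa using le_antisymm hD0 (sq_nonneg _)

/-- Comparison between the individual policies produced by the original
cross-learning projection and those of the relaxed projection: if `‖ḡ − g'‖ ≤ ε` then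
`‖h_i − h_i'‖ ≤ ε (2 + √N y_i / √(Σ_j y_j²))` where `y_i = ‖h̄_i − g'‖`. -/
theorem stmt5 {H : Type*} [NormedAddCommGroup H] [InnerProductSpace ℝ H] [CompleteSpace H]
    {N : ℕ} (hN : 1 ≤ N) {ε : ℝ} (hε : 0 < ε)
    (hbar : Fin N → H) (gbar : H) (h : Fin N → H) (g : H)
    (hfeas : ∀ i, ‖h i - g‖ ≤ ε)
    (hmin : ∀ (h'' : Fin N → H) (g'' : H), (∀ i, ‖h'' i - g''‖ ≤ ε) →
      (∑ i, ‖h i - hbar i‖ ^ 2) + ‖g - gbar‖ ^ 2 ≤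
        (∑ i, ‖h'' i - hbar i‖ ^ 2) + ‖g'' - gbar‖ ^ 2)
    (g' : H) (hg' : g' = (N : ℝ)⁻¹ • ∑ j, hbar j)
    (y : Fin N → ℝ) (hy : ∀ i, y i = ‖hbar i - g'‖)
    (hpos : 0 < ∑ j, y j ^ 2)
    (ψ : ℝ) (hψ : ψ = min 1 (Real.sqrt N * ε / Real.sqrt (∑ j, y j ^ 2)))
    (h' : Fin N → H) (hh' : ∀ i, h' i = (1 - ψ) • g' + ψ • hbar i)
    (hnear : ‖gbar - g'‖ ≤ ε) :
    ∀ i, ‖h i - h' i‖ ≤ ε * (2 + Real.sqrt N * y i / Real.sqrt (∑ j, y j ^ 2)) := by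
  have hN0 : (N : ℝ) ≠ 0 := by positivity
  have hbal : ∑ i, (h i - hbar i) + (g - gbar) = 0 := by
    refine sum_residual_add_eq_zero _ _ fun v => ?_
    have := hmin (fun i => h i + v) (g + v) (by simpa using hfeas)
    simpa only [sub_add_eq_add_sub] using this
  have hsum : ∑ j, hbar j = (N : ℝ) • g' := by rw [hg', smul_inv_smul₀ hN0]
  have hcenter : ((N : ℝ) + 1) • (g - g') = (gbar - g') - ∑ i, (h i - g) := by
    rw [Finset.sum_sub_distrib, hsum] at hbal
    rw [Finset.sum_sub_distrib, Finset.sum_const, Finset.card_univ, Fintype.card_fin,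
      ← Nat.cast_smul_eq_nsmul ℝ]
    linear_combination (norm := module) hbal
  have hgg' : ‖g - g'‖ ≤ ε := by
    have h1 : ‖((N : ℝ) + 1) • (g - g')‖ ≤ ε + N * ε := by
      rw [hcenter]
      refine (norm_sub_le _ _).trans (add_le_add hnear ?_)
      simpa using norm_sum_le_of_le Finset.univ fun i _ => hfeas i
    have hN1 : (0 : ℝ) < N + 1 := by positivity
    rw [norm_smul, Real.norm_of_nonneg hN1.le] at h1
    exact le_of_mul_le_mul_left (by linarith) hN1
  intro i
  have hψ0 : 0 ≤ ψ := by rw [hψ]; positivity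
  have hh'g' : ‖g' - h' i‖ = ψ * y i := by
    rw [hh', hy, ← Real.norm_of_nonneg hψ0, ← norm_smul, ← norm_neg, Real.norm_of_nonneg hψ0]
    congr 1
    module
  have hψy : ψ * y i ≤ √N * ε / √(∑ j, y j ^ 2) * y i := by
    have : 0 ≤ y i := by rw [hy]; positivity
    gcongr
    exact hψ ▸ min_le_right _ _
  calc ‖h i - h' i‖ = ‖(h i - g) + (g - g') + (g' - h' i)‖ := by congr 1; abel
    _ ≤ ‖h i - g‖ + ‖g - g'‖ + ‖g' - h' i‖ := norm_add₃_le
    _ ≤ ε + ε + √N * ε / √(∑ j, y j ^ 2) * y i := by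
      rw [hh'g']
      exact add_le_add (add_le_add (hfeas i) hgg') hψy
    _ = ε * (2 + √N * y i / √(∑ j, y j ^ 2)) := by ring
end

section
/- Let (Ω, F, P) be a probability space, let γ_F > 0, let K : Ω → ℕ be a measurable random variable, and let G : Ω → ℝ be an integrable random variable. Suppose that for every t ∈ ℕ with P(K = t) > 0, the conditional expectation satisfies E[G | K = t] ≥ γ_F · t. Then K is integrable and E[K] ≤ E[G] / γ_F. -/
open MeasureTheory

/-- If `E[G | K = t] ≥ γ_F t` for all `t` with `P(K = t) > 0`, then `K` is
integrable and `E[K] ≤ E[G] / γ_F`. -/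
theorem stmt9 {Ω : Type*} [MeasurableSpace Ω] (P : Measure Ω) [IsProbabilityMeasure P]
    {γF : ℝ} (hγF : 0 < γF)
    (K : Ω → ℕ) (hK : Measurable K)
    (G : Ω → ℝ) (hG : Integrable G P)
    (hcond : ∀ t : ℕ, 0 < P {ω | K ω = t} →
      γF * t ≤ (∫ ω in {ω | K ω = t}, G ω ∂P) / (P {ω | K ω = t}).toReal) :
    Integrable (fun ω => (K ω : ℝ)) P ∧
      ∫ ω, (K ω : ℝ) ∂P ≤ (∫ ω, G ω ∂P) / γF := by
  have hmeas (t : ℕ) : MeasurableSet {ω | K ω = t} := hK (measurableSet_singleton t)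
  have hdisj : Pairwise (Function.onFun Disjoint fun t : ℕ => {ω | K ω = t}) :=
    fun s t hst => Set.disjoint_left.2 fun _ hs ht => hst (hs.symm.trans ht)
  have hunion : ⋃ t : ℕ, {ω | K ω = t} = Set.univ :=
    Set.eq_univ_of_forall fun ω => Set.mem_iUnion.2 ⟨K ω, rfl⟩
  have hfiber (t : ℕ) : ∫ ω in {ω | K ω = t}, (K ω : ℝ) ∂P = P.real {ω | K ω = t} * t := by
    rw [setIntegral_congr_fun (hmeas t) (g := fun _ => (t : ℝ))
      fun ω (hω : K ω = t) => congrArg Nat.cast hω]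
    simp
  have hle (t : ℕ) : ∫ ω in {ω | K ω = t}, (K ω : ℝ) ∂P ≤
      (∫ ω in {ω | K ω = t}, G ω ∂P) / γF := by
    rw [hfiber, le_div_iff₀ hγF]
    rcases eq_or_ne (P {ω | K ω = t}) 0 with h | h
    · simp [Measure.real, h, Measure.restrict_eq_zero.2 h]
    · have hpos : 0 < (P {ω | K ω = t}).toReal := ENNReal.toReal_pos h (measure_ne_top _ _)
      have := (le_div_iff₀ hpos).1 (hcond t (pos_iff_ne_zero.2 h))
      rw [Measure.real]
      linarith
  have hGsum : HasSum (fun t : ℕ => (∫ ω in {ω | K ω = t}, G ω ∂P) / γF)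
      ((∫ ω, G ω ∂P) / γF) := by
    have := hasSum_integral_iUnion hmeas hdisj hG.integrableOn
    rw [hunion, setIntegral_univ] at this
    exact this.div_const γF
  have hKint : Integrable (fun ω => (K ω : ℝ)) P := by
    rw [← integrableOn_univ, ← hunion]
    refine integrableOn_iUnion_of_summable_integral_norm (fun t => ?_) ?_
    · exact (integrableOn_const (C := (t : ℝ))).congr_fun
        (fun ω (hω : K ω = t) => congrArg Nat.cast hω.symm) (hmeas t)
    · simp only [Real.norm_natCast]
      exact Summable.of_nonneg_of_le (fun t => integral_nonneg fun ω => Nat.cast_nonneg _)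
        hle hGsum.summable
  have hKsum := hasSum_integral_iUnion hmeas hdisj hKint.integrableOn
  rw [hunion, setIntegral_univ] at hKsum
  exact ⟨hKint, hasSum_le hle hKsum hGsum⟩
end
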